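/- Let 0 < α < 1, ζ > 0, κ > 0. Then for every λ > 0, ∫_{1/(ζ+κ)}^{1/ζ} ((λ/u)^{−α} e^{−λ/u} / Γ(1−α)) · (α u^{−α−1} / ((ζ+κ)^α − ζ^α)) · (1/u) du = (1 − e^{−λκ}) λ^{−α−1} e^{−ζλ} / (Γ(1−α) · Ψ_{α,ζ}(κ)). Consequently, if G ~ Gamma(1−α, 1) and, independently, U has density (α/((ζ+κ)^α − ζ^α)) u^{−α−1} on (1/(ζ+κ), 1/ζ), then the product G·U has density (1 − e^{−λκ}) λ^{−α−1} e^{−ζλ} / (Γ(1−α) Ψ_{α,ζ}(κ)) on (0,∞). -/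

import Mathlib

open MeasureTheory

/-- Product-density identity for the mixing density of `MtP(κ, ν_{α,ζ})`:
for `0 < α < 1`, `ζ > 0`, `κ > 0` and every `λ > 0`, the product-density
convolution of the `Gamma(1−α,1)` density with the density
`(α/((ζ+κ)^α − ζ^α)) u^{−α−1}` on `(1/(ζ+κ), 1/ζ)` equals
`(1 − e^{−λκ}) λ^{−α−1} e^{−ζλ}/(Γ(1−α) Ψ_{α,ζ}(κ))`, where
`Ψ_{α,ζ}(κ) = ((κ+ζ)^α − ζ^α)/α`.  Consequently, if `G ∼ Gamma(1−α,1)` and,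
independently, `U` has the second density, then `G·U` has the latter density. -/
theorem stmt_5 (α ζ κ : ℝ) (hα0 : 0 < α) (hα1 : α < 1) (hζ : 0 < ζ) (hκ : 0 < κ) :
    ∀ l : ℝ, 0 < l →
      (∫ u in Set.Ioo (1 / (ζ + κ)) (1 / ζ),
          ((l / u) ^ (-α) * Real.exp (-(l / u)) / Real.Gamma (1 - α)) *
            (α * u ^ (-α - 1) / ((ζ + κ) ^ α - ζ ^ α)) * (1 / u))
        = (1 - Real.exp (-l * κ)) * l ^ (-α - 1) * Real.exp (-ζ * l) /
            (Real.Gamma (1 - α) * (((κ + ζ) ^ α - ζ ^ α) / α)) := by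
  intro l hl
  have hζκ : 0 < ζ + κ := by linarith
  have hab : 1 / (ζ + κ) ≤ 1 / ζ := one_div_le_one_div_of_le hζ (by linarith)
  have ha : 0 < 1 / (ζ + κ) := by positivity
  have hG : 0 < Real.Gamma (1 - α) := Real.Gamma_pos_of_pos (by linarith)
  have hD : 0 < (ζ + κ) ^ α - ζ ^ α :=
    sub_pos.mpr (Real.rpow_lt_rpow hζ.le (by linarith) hα0)
  set D := (ζ + κ) ^ α - ζ ^ α with hDdef
  set C := α / (Real.Gamma (1 - α) * D) * l ^ (-α - 1) with hC
  have hl1 : l ^ (-α) = l ^ (-α - 1) * l := by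
    rw [Real.rpow_sub_one hl.ne']
    field_simp
  have hcongr : ∀ u ∈ Set.Ioc (1 / (ζ + κ)) (1 / ζ),
      ((l / u) ^ (-α) * Real.exp (-(l / u)) / Real.Gamma (1 - α)) *
            (α * u ^ (-α - 1) / D) * (1 / u)
        = C * (Real.exp (-(l / u)) * (l / u ^ 2)) := by
    intro u hu
    have hu0 : 0 < u := ha.trans hu.1
    have hup : 0 < u ^ (-α) := Real.rpow_pos_of_pos hu0 _
    rw [Real.div_rpow hl.le hu0.le, Real.rpow_sub_one hu0.ne', hl1, hC]
    field_simp
  rw [← integral_Ioc_eq_integral_Ioo, setIntegral_congr_fun measurableSet_Ioc hcongr,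
    ← intervalIntegral.integral_of_le hab]
  have hpos : ∀ u ∈ Set.uIcc (1 / (ζ + κ)) (1 / ζ), u ≠ 0 := by
    intro u hu
    rw [Set.uIcc_of_le hab] at hu
    exact (ha.trans_le hu.1).ne'
  rw [intervalIntegral.integral_eq_sub_of_hasDerivAt
    (f := fun u => C * Real.exp (-(l / u)))]
  · have h1 : -(l / (1 / ζ)) = -ζ * l := by field_simp
    have h2 : -(l / (1 / (ζ + κ))) = -l * κ + -ζ * l := by field_simp; ring
    simp only [h1, h2, Real.exp_add, hC, add_comm κ ζ, ← hDdef]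
    field_simp
  · intro u hu
    have hu0 := hpos u hu
    have h0 : HasDerivAt (fun v : ℝ => -(l / v)) (l / u ^ 2) u := by
      have h := ((hasDerivAt_inv hu0).const_mul l).fun_neg
      simp only [← div_eq_mul_inv] at h
      refine h.congr_deriv ?_
      field_simp
    exact h0.exp.const_mul C
  · apply ContinuousOn.intervalIntegrable
    have hp2 : ∀ u ∈ Set.uIcc (1 / (ζ + κ)) (1 / ζ), u ^ 2 ≠ 0 :=
      fun u hu => pow_ne_zero 2 (hpos u hu)
    fun_prop (disch := assumption)
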